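/- Fix a positive integer h and suppose the series Σ_{q=1}^∞ (μ(q)²/φ(q)²) c_q(h) converges to a complex number C(h). For each real z with 0 < z < 1 set f(z,n) = Σ_{q=1}^∞ (μ(q)/φ(q)) z^q c_q(n) (this series converges absolutely since Σ_{q=1}^∞ |μ(q)/φ(q)| φ(q) z^q ≤ z/(1−z) < ∞). Then for each z ∈ (0,1) the limit L(z) = lim_{N→∞} (1/N) Σ_{n=1}^{N} f(z,n) f(z, n + h) exists and equals Σ_{q=1}^∞ (μ(q)²/φ(q)²) z^{2q} c_q(h), and lim_{z→1⁻} L(z) = C(h); that is, the correlation lim_{N→∞} (1/N) Σ_{n=1}^{N} (φ(n)Λ(n)/n)(φ(n+h)Λ(n+h)/(n+h)) arising from the Ramanujan–Fourier coefficients a_q = μ(q)/φ(q) is Abel summable to C(h). -/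

import Mathlib

open Finset Filter ArithmeticFunction

/-- The Ramanujan sum `c_q(n) = Σ_{k=1, gcd(k,q)=1}^{q} exp(2πi k n / q)`. -/
noncomputable def ramanujanSum (q : ℕ) (n : ℤ) : ℂ :=
  ∑ k ∈ (Finset.Icc 1 q).filter (fun k => Nat.gcd k q = 1),
    Complex.exp (2 * Real.pi * Complex.I * (k : ℂ) * (n : ℂ) / (q : ℂ))

theorem ramanujanSum_eq_sum_primitiveRoots {q : ℕ} (hq : q ≠ 0) (n : ℕ) :
    ramanujanSum q (n : ℤ) = ∑ w ∈ primitiveRoots q ℂ, w ^ n := by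
  have hprim := Complex.isPrimitiveRoot_exp q hq
  have hq' : (q : ℂ) ≠ 0 := Nat.cast_ne_zero.mpr hq
  have hpos : 0 < q := Nat.pos_of_ne_zero hq
  have : NeZero q := ⟨hq⟩
  refine Finset.sum_nbij (fun k => Complex.exp (2 * Real.pi * Complex.I / q) ^ k) ?_ ?_ ?_ ?_
  · intro k hk
    rw [mem_primitiveRoots hpos]
    exact hprim.pow_of_coprime k (Finset.mem_filter.mp hk).2
  · intro k hk l hl hkl
    simp only [Finset.coe_filter, Finset.mem_Icc, Set.mem_ofPred_eq] at hk hl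
    obtain ⟨k, rfl⟩ := Nat.exists_eq_add_of_le' hk.1.1
    obtain ⟨l, rfl⟩ := Nat.exists_eq_add_of_le' hl.1.1
    simp only [pow_succ] at hkl
    rw [hprim.pow_inj (by omega) (by omega) (mul_right_cancel₀ (Complex.exp_ne_zero _) hkl)]
  · intro w hw
    rw [Finset.mem_coe, mem_primitiveRoots hpos] at hw
    obtain ⟨i, hi, rfl⟩ := hprim.eq_pow_of_pow_eq_one hw.pow_eq_one
    have hcop : i.Coprime q := (hprim.pow_iff_coprime hpos i).mp hw
    rcases Nat.eq_zero_or_pos i with rfl | hi0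
    · have hq1 : q = 1 := by simpa using hcop
      subst hq1
      exact ⟨1, by simp, by simp⟩
    · refine ⟨i, ?_, rfl⟩
      simp only [Finset.coe_filter, Finset.mem_Icc, Set.mem_ofPred_eq]
      exact ⟨⟨hi0, hi.le⟩, hcop⟩
  · intro k _
    rw [← pow_mul, ← Complex.exp_nat_mul]
    congr 1
    push_cast
    ring

theorem norm_ramanujanSum_le {q : ℕ} (hq : q ≠ 0) (n : ℕ) :
    ‖ramanujanSum q (n : ℤ)‖ ≤ q.totient := by
  rw [ramanujanSum_eq_sum_primitiveRoots hq, ← Complex.card_primitiveRoots q]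
  refine (norm_sum_le_of_le (f := fun w : ℂ => w ^ n) (n := fun _ => 1) _ fun w hw => ?_).trans
    (by simp)
  rw [norm_pow, (isPrimitiveRoot_of_mem_primitiveRoots hw).norm'_eq_one hq, one_pow]

theorem tendsto_mean_pow {w : ℂ} (hw : ‖w‖ = 1) :
    Tendsto (fun N : ℕ => (N : ℂ)⁻¹ * ∑ n ∈ Finset.Icc 1 N, w ^ n) atTop
      (nhds (if w = 1 then 1 else 0)) := by
  split_ifs with h1
  · subst h1
    refine tendsto_const_nhds.congr' ?_
    filter_upwards [eventually_ne_atTop 0] with N hN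
    simp [hN]
  · have hsum : ∀ N : ℕ, ∑ n ∈ Finset.Icc 1 N, w ^ n = w * ((w ^ N - 1) / (w - 1)) := by
      intro N
      rw [← geom_sum_eq h1, Finset.mul_sum, Finset.range_eq_Ico,
        ← Finset.Ico_add_one_right_eq_Icc, ← Finset.sum_Ico_add' _ 0 N 1]
      exact Finset.sum_congr rfl fun n _ => pow_succ' w n
    simp only [hsum]
    refine Tendsto.zero_mul_isBoundedUnder_le tendsto_inv_atTop_nhds_zero_nat ?_
    refine isBoundedUnder_of ⟨2 / ‖w - 1‖, fun N => ?_⟩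
    simp only [Function.comp_apply, norm_mul, norm_div, hw, one_mul]
    gcongr
    refine (norm_sub_le _ _).trans ?_
    simp only [norm_pow, hw, one_pow, norm_one]
    norm_num

theorem tendsto_mean_ramanujanSum_mul {q r : ℕ} (hq : q ≠ 0) (hr : r ≠ 0) (h : ℕ) :
    Tendsto (fun N : ℕ => (N : ℂ)⁻¹ * ∑ n ∈ Finset.Icc 1 N,
        ramanujanSum q (n : ℤ) * ramanujanSum r ((n + h : ℕ) : ℤ)) atTop
      (nhds (if q = r then ramanujanSum r (h : ℤ) else 0)) := by
  have hexp : ∀ N : ℕ, (N : ℂ)⁻¹ * ∑ n ∈ Finset.Icc 1 N,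
      ramanujanSum q (n : ℤ) * ramanujanSum r ((n + h : ℕ) : ℤ) =
      ∑ v ∈ primitiveRoots r ℂ, ∑ w ∈ primitiveRoots q ℂ,
        ((N : ℂ)⁻¹ * ∑ n ∈ Finset.Icc 1 N, (w * v) ^ n) * v ^ h := by
    intro N
    simp only [ramanujanSum_eq_sum_primitiveRoots hq, ramanujanSum_eq_sum_primitiveRoots hr,
      Finset.mul_sum, Finset.sum_mul]
    rw [Finset.sum_comm]
    refine Finset.sum_congr rfl fun v _ => ?_
    rw [Finset.sum_comm]
    refine Finset.sum_congr rfl fun w _ => Finset.sum_congr rfl fun n _ => ?_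
    ring
  simp only [hexp]
  have hlim : (if q = r then ramanujanSum r (h : ℤ) else 0) =
      ∑ v ∈ primitiveRoots r ℂ, ∑ w ∈ primitiveRoots q ℂ,
        (if w * v = 1 then 1 else 0) * v ^ h := by
    have hinner : ∀ v ∈ primitiveRoots r ℂ, ∑ w ∈ primitiveRoots q ℂ,
        (if w * v = 1 then (1 : ℂ) else 0) * v ^ h = if q = r then v ^ h else 0 := by
      intro v hv
      have hv' := isPrimitiveRoot_of_mem_primitiveRoots hv
      have hv0 : v ≠ 0 := hv'.ne_zero hr
      simp only [mul_eq_one_iff_eq_inv₀ hv0, ite_mul, one_mul, zero_mul, Finset.sum_ite_eq']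
      congr 1
      rw [mem_primitiveRoots (Nat.pos_of_ne_zero hq)]
      exact propext ⟨fun hvq => hvq.unique hv'.inv, fun hqr => hqr ▸ hv'.inv⟩
    rw [Finset.sum_congr rfl hinner]
    split_ifs
    · exact ramanujanSum_eq_sum_primitiveRoots hr h
    · simp
  rw [hlim]
  refine tendsto_finsetSum _ fun v hv => tendsto_finsetSum _ fun w hw =>
    (tendsto_mean_pow ?_).mul_const _
  rw [norm_mul, (isPrimitiveRoot_of_mem_primitiveRoots hv).norm'_eq_one hr,
    (isPrimitiveRoot_of_mem_primitiveRoots hw).norm'_eq_one hq, one_mul]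

theorem norm_moebius_div_totient_mul_le (q : ℕ) (z : ℝ) (hz : 0 ≤ z) (n : ℕ) :
    ‖((moebius q : ℂ) / (Nat.totient q : ℂ)) * (z : ℂ) ^ q * ramanujanSum q (n : ℤ)‖ ≤ z ^ q := by
  rcases eq_or_ne q 0 with rfl | hq
  · simp
  have hφ : (0 : ℝ) < q.totient := by exact_mod_cast Nat.totient_pos.mpr (Nat.pos_of_ne_zero hq)
  have hμ : ‖(moebius q : ℂ)‖ ≤ 1 := by
    rw [Complex.norm_intCast]
    exact_mod_cast abs_moebius_le_one
  rw [norm_mul, norm_mul, norm_div, norm_pow, Complex.norm_natCast, Complex.norm_real,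
    Real.norm_of_nonneg hz]
  calc _ ≤ 1 / (q.totient : ℝ) * z ^ q * q.totient := by
        gcongr
        exact norm_ramanujanSum_le hq n
    _ = z ^ q := by field_simp

theorem tendsto_mean_ramanujanSeries_mul (h : ℕ) (z : ℝ) (hz0 : 0 ≤ z) (hz1 : z < 1) :
    Tendsto (fun N : ℕ => (N : ℂ)⁻¹ * ∑ n ∈ Finset.Icc 1 N,
      (∑' q : ℕ, ((moebius q : ℂ) / (Nat.totient q : ℂ)) * (z : ℂ) ^ q *
        ramanujanSum q (n : ℤ)) *
      (∑' q : ℕ, ((moebius q : ℂ) / (Nat.totient q : ℂ)) * (z : ℂ) ^ q *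
        ramanujanSum q ((n + h : ℕ) : ℤ))) atTop
      (nhds (∑' q : ℕ, ((moebius q : ℂ) ^ 2 / (Nat.totient q : ℂ) ^ 2) * (z : ℂ) ^ (2 * q) *
        ramanujanSum q (h : ℤ))) := by
  set t : ℕ → ℕ → ℂ := fun n q =>
    ((moebius q : ℂ) / (Nat.totient q : ℂ)) * (z : ℂ) ^ q * ramanujanSum q (n : ℤ) with ht
  have hgeom : Summable fun q : ℕ => z ^ q := summable_geometric_of_lt_one hz0 hz1
  have htn : ∀ n q, ‖t n q‖ ≤ z ^ q := fun n q => norm_moebius_div_totient_mul_le q z hz0 n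
  have hts : ∀ n, Summable fun q => ‖t n q‖ := fun n =>
    hgeom.of_nonneg_of_le (fun _ => norm_nonneg _) (htn n)
  have hbound : Summable fun p : ℕ × ℕ => z ^ p.1 * z ^ p.2 :=
    hgeom.mul_of_nonneg hgeom (fun _ => pow_nonneg hz0 _) (fun _ => pow_nonneg hz0 _)
  have hprod : ∀ n, Summable fun p : ℕ × ℕ => t n p.1 * t (n + h) p.2 := fun n =>
    summable_mul_of_summable_norm (hts n) (hts (n + h))
  have hleft : ∀ N : ℕ, (N : ℂ)⁻¹ * ∑ n ∈ Finset.Icc 1 N, (∑' q, t n q) * (∑' q, t (n + h) q) =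
      ∑' p : ℕ × ℕ, (N : ℂ)⁻¹ * ∑ n ∈ Finset.Icc 1 N, t n p.1 * t (n + h) p.2 := by
    intro N
    rw [tsum_mul_left, Summable.tsum_finsetSum fun n _ => hprod n]
    congr 1
    exact Finset.sum_congr rfl fun n _ =>
      tsum_mul_tsum_of_summable_norm (hts n) (hts (n + h))
  set g : ℕ → ℂ := fun q => ((moebius q : ℂ) ^ 2 / (Nat.totient q : ℂ) ^ 2) *
    (z : ℂ) ^ (2 * q) * ramanujanSum q (h : ℤ) with hg
  have hright : ∑' q, g q = ∑' p : ℕ × ℕ, if p.1 = p.2 then g p.2 else 0 := by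
    have hinj : Function.Injective fun q : ℕ => (q, q) := fun a b hab => congrArg Prod.fst hab
    rw [← hinj.tsum_eq]
    · simp
    · rintro ⟨a, b⟩ hab
      have : a = b := by
        by_contra hne
        simp [hne] at hab
      exact ⟨a, by simp [this]⟩
  change Tendsto (fun N : ℕ => (N : ℂ)⁻¹ * ∑ n ∈ Finset.Icc 1 N,
    (∑' q, t n q) * (∑' q, t (n + h) q)) atTop (nhds (∑' q, g q))
  simp only [hleft]
  rw [hright]
  refine tendsto_tsum_of_dominated_convergence hbound ?_ (Eventually.of_forall fun N p => ?_)
  · rintro ⟨q, r⟩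
    rcases eq_or_ne q 0 with rfl | hq
    · have : (if (0 : ℕ) = r then g r else 0) = 0 := by
        split_ifs with h0
        · simp [hg, ← h0]
        · rfl
      simp [ht, this]
    rcases eq_or_ne r 0 with rfl | hr
    · simp [ht, hq]
    have hmean := (tendsto_mean_ramanujanSum_mul hq hr h).const_mul
      ((moebius q : ℂ) / (Nat.totient q : ℂ) * (z : ℂ) ^ q *
        ((moebius r : ℂ) / (Nat.totient r : ℂ) * (z : ℂ) ^ r))
    convert hmean using 1
    · funext N
      simp only [ht, Finset.mul_sum]
      refine Finset.sum_congr rfl fun n _ => ?_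
      ring
    · congr 1
      dsimp only
      split_ifs with hqr
      · subst hqr
        simp only [hg]
        ring
      · simp
  · rw [norm_mul, norm_inv, Complex.norm_natCast]
    have hle : ‖∑ n ∈ Finset.Icc 1 N, t n p.1 * t (n + h) p.2‖ ≤ N * (z ^ p.1 * z ^ p.2) := by
      refine (norm_sum_le_of_le (n := fun _ => z ^ p.1 * z ^ p.2) _ fun n _ => ?_).trans
        (by simp)
      rw [norm_mul]
      exact mul_le_mul (htn _ _) (htn _ _) (norm_nonneg _) (pow_nonneg hz0 _)
    rcases Nat.eq_zero_or_pos N with rfl | hN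
    · simp only [Nat.cast_zero, inv_zero, zero_mul]
      positivity
    · rwa [inv_mul_le_iff₀ (by exact_mod_cast hN)]

theorem stmt_9 (h : ℕ) (hh : 0 < h) (C : ℂ)
    (hC : HasSum (fun q : ℕ =>
      ((moebius q : ℂ) ^ 2 / (Nat.totient q : ℂ) ^ 2) * ramanujanSum q (h : ℤ)) C)
    (f : ℝ → ℕ → ℂ)
    (hf : ∀ z : ℝ, ∀ n : ℕ, f z n =
      ∑' q : ℕ, ((moebius q : ℂ) / (Nat.totient q : ℂ)) * (z : ℂ) ^ q * ramanujanSum q (n : ℤ))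
    :
    ((∀ z : ℝ, 0 < z → z < 1 →
      Tendsto (fun N : ℕ => (N : ℂ)⁻¹ * ∑ n ∈ Finset.Icc 1 N, f z n * f z (n + h))
        atTop
        (nhds (∑' q : ℕ,
          ((moebius q : ℂ) ^ 2 / (Nat.totient q : ℂ) ^ 2) * (z : ℂ) ^ (2 * q) *
            ramanujanSum q (h : ℤ)))) ∧
    Tendsto (fun z : ℝ => ∑' q : ℕ,
        ((moebius q : ℂ) ^ 2 / (Nat.totient q : ℂ) ^ 2) * (z : ℂ) ^ (2 * q) *
          ramanujanSum q (h : ℤ))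
      (nhdsWithin 1 (Set.Ioo (0 : ℝ) 1)) (nhds C)) := by
  constructor
  · intro z hz0 hz1
    simp only [hf]
    exact tendsto_mean_ramanujanSeries_mul h z hz0.le hz1
  · rw [← hC.tsum_eq]
    refine tendsto_tsum_of_dominated_convergence hC.summable.norm (fun q => ?_) ?_
    · have hcont : Continuous fun z : ℝ =>
          ((moebius q : ℂ) ^ 2 / (Nat.totient q : ℂ) ^ 2) * (z : ℂ) ^ (2 * q) *
            ramanujanSum q (h : ℤ) := by fun_prop
      simpa using (hcont.tendsto 1).mono_left nhdsWithin_le_nhds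
    · filter_upwards [self_mem_nhdsWithin] with z hz q
      rw [mul_right_comm, norm_mul, norm_pow, Complex.norm_real, Real.norm_of_nonneg hz.1.le]
      exact mul_le_of_le_one_right (norm_nonneg _) (pow_le_one₀ hz.1.le hz.2.le)
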